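/- arXiv:math/0109069 — 2 statements merged into one kernel-verified Lean document; each statement's English description precedes it below -/
import Mathlib

section
/- Let Γ be a d-regular graph with isoperimetric constant ι and spectral radius μ of the simple random walk. Then 1 − ((d−1)/d²)·ι ≤ μ ≤ √(1 − (ι/d)²). -/
open Filter

namespace IsoSpec

section
variable {V : Type*}

/-- adjacency operator on finitely supported functions -/
noncomputable def adj (nb : V → Finset V) : (V →₀ ℝ) →ₗ[ℝ] (V →₀ ℝ) :=
  Finsupp.linearCombination ℝ (fun v => ∑ y ∈ nb v, Finsupp.single y (1:ℝ))

/-- inner product -/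
noncomputable def ip (f g : V →₀ ℝ) : ℝ := f.sum (fun u a => a * g u)

lemma ip_eq (f g : V →₀ ℝ) (T : Finset V) (h : f.support ⊆ T) :
    ip f g = ∑ u ∈ T, f u * g u := by
  unfold ip
  exact Finsupp.sum_of_support_subset f h _ (by simp)

lemma ip_comm (f g : V →₀ ℝ) : ip f g = ip g f := by
  classical
  rw [ip_eq f g (f.support ∪ g.support) Finset.subset_union_left,
    ip_eq g f (f.support ∪ g.support) Finset.subset_union_right]
  exact Finset.sum_congr rfl fun _ _ => mul_comm _ _

lemma ip_add_left (f g k : V →₀ ℝ) : ip (f + g) k = ip f k + ip g k := by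
  classical
  unfold ip
  exact Finsupp.sum_add_index' (by simp) (by intros; ring)

lemma ip_smul_left (c : ℝ) (f k : V →₀ ℝ) : ip (c • f) k = c * ip f k := by
  classical
  unfold ip
  rw [Finsupp.sum_smul_index' (by simp), Finsupp.mul_sum]
  refine Finset.sum_congr rfl fun u _ => ?_
  simp [mul_assoc]

lemma ip_add_right (f g k : V →₀ ℝ) : ip k (f + g) = ip k f + ip k g := by
  rw [ip_comm, ip_add_left, ip_comm f, ip_comm g]

lemma ip_smul_right (c : ℝ) (f k : V →₀ ℝ) : ip k (c • f) = c * ip k f := by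
  rw [ip_comm, ip_smul_left, ip_comm f]

lemma ip_single_left (u : V) (c : ℝ) (g : V →₀ ℝ) : ip (Finsupp.single u c) g = c * g u := by
  unfold ip; simp

lemma ip_single_right (u : V) (c : ℝ) (g : V →₀ ℝ) : ip g (Finsupp.single u c) = c * g u := by
  rw [ip_comm, ip_single_left]

lemma ip_self_nonneg (f : V →₀ ℝ) : 0 ≤ ip f f :=
  Finset.sum_nonneg fun _ _ => mul_self_nonneg _

lemma ip_cs (f g : V →₀ ℝ) : (ip f g)^2 ≤ ip f f * ip g g := by
  classical
  rw [ip_eq f g (f.support ∪ g.support) Finset.subset_union_left,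
    ip_eq f f (f.support ∪ g.support) Finset.subset_union_left,
    ip_eq g g (f.support ∪ g.support) Finset.subset_union_right]
  have := Finset.sum_mul_sq_le_sq_mul_sq (f.support ∪ g.support) f g
  simpa [sq] using this

lemma adj_apply (nb : V → Finset V) (hs : ∀ u v, u ∈ nb v ↔ v ∈ nb u) (f : V →₀ ℝ) (u : V) :
    adj nb f u = ∑ v ∈ nb u, f v := by
  classical
  induction f using Finsupp.induction_linear with
  | zero => simp
  | add f g hf hg => simp [hf, hg, Finset.sum_add_distrib]
  | single a b =>
    simp [adj, Finsupp.single_apply, hs u a]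

lemma adj_symm (nb : V → Finset V) (hs : ∀ u v, u ∈ nb v ↔ v ∈ nb u) (f g : V →₀ ℝ) :
    ip (adj nb f) g = ip f (adj nb g) := by
  classical
  induction f using Finsupp.induction_linear with
  | zero => simp [ip]
  | add f f' hf hf' => simp [ip_add_left, hf, hf']
  | single a b =>
    rw [ip_single_left, adj_apply nb hs]
    have : ∀ s : Finset V, ip (∑ y ∈ s, Finsupp.single y (1:ℝ)) g = ∑ y ∈ s, g y := by
      intro s
      induction s using Finset.induction_on with
      | empty => simp [ip]
      | insert a s ha ih => rw [Finset.sum_insert ha, Finset.sum_insert ha, ip_add_left, ih, ip_single_left, one_mul]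
    simp only [adj, Finsupp.linearCombination_single, ip_smul_left, this]

lemma coarea [DecidableEq V] (nb : V → Finset V) (ι : ℝ)
    (hiso : ∀ K : Finset V, ι * K.card ≤ ∑ u ∈ K, ((nb u \ K).card : ℝ)) (S : Finset V) :
    ∀ q : V → ℝ, (∀ u, 0 ≤ q u) → (∀ u, u ∉ S → q u = 0) →
      ι * ∑ u ∈ S, q u ≤ ∑ u ∈ S, ∑ v ∈ nb u, max (q u - q v) 0 := by
  induction S using Finset.strongInduction with
  | H S ih =>
  intro q hq h0
  rcases S.eq_empty_or_nonempty with rfl | hne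
  · simp
  obtain ⟨u0, hu0, hmin⟩ := S.exists_min_image q hne
  set q' : V → ℝ := fun u => if u ∈ S then q u - q u0 else 0 with hq'
  have h1 : ∀ u, 0 ≤ q' u := by
    intro u; simp only [hq']; split_ifs with h
    · linarith [hmin u h]
    · exact le_rfl
  have hz : q' u0 = 0 := by simp [hq']
  have h2 := ih (S.erase u0) (Finset.erase_ssubset hu0) q' h1 (by
    intro u hu
    by_cases h : u ∈ S
    · have : u = u0 := by by_contra hh; exact hu (Finset.mem_erase.2 ⟨hh, h⟩)
      rw [this, hz]
    · simp [hq', h])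
  have e1 : ∑ u ∈ S.erase u0, q' u = ∑ u ∈ S, q' u := by
    rw [← Finset.add_sum_erase S _ hu0, hz, zero_add]
  have e2 : ∑ u ∈ S.erase u0, ∑ v ∈ nb u, max (q' u - q' v) 0
      = ∑ u ∈ S, ∑ v ∈ nb u, max (q' u - q' v) 0 := by
    rw [← Finset.add_sum_erase S _ hu0]
    have : ∑ v ∈ nb u0, max (q' u0 - q' v) 0 = 0 :=
      Finset.sum_eq_zero fun v _ => by rw [hz]; exact max_eq_right (by linarith [h1 v])
    rw [this, zero_add]
  rw [e1, e2] at h2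
  have e3 : ∑ u ∈ S, q u = ∑ u ∈ S, q' u + q u0 * S.card := by
    have : ∀ u ∈ S, q u = q' u + q u0 := by intro u hu; simp [hq', hu]
    rw [Finset.sum_congr rfl this, Finset.sum_add_distrib]; simp [mul_comm]
  have e4 : ∑ u ∈ S, ∑ v ∈ nb u, max (q u - q v) 0 =
      ∑ u ∈ S, ∑ v ∈ nb u, max (q' u - q' v) 0 + q u0 * ∑ u ∈ S, ((nb u \ S).card : ℝ) := by
    rw [Finset.mul_sum, ← Finset.sum_add_distrib]
    refine Finset.sum_congr rfl fun u hu => ?_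
    have : q u0 * ((nb u \ S).card : ℝ) = ∑ v ∈ nb u, if v ∉ S then q u0 else 0 := by
      rw [← Finset.sum_filter, Finset.sum_const, Finset.sdiff_eq_filter, nsmul_eq_mul, mul_comm]
    rw [this, ← Finset.sum_add_distrib]
    refine Finset.sum_congr rfl fun v hv => ?_
    by_cases hvS : v ∈ S
    · simp [hq', hu, hvS]
    · simp only [hq', hu, hvS, h0 v hvS, if_true, if_false, not_false_eq_true, sub_zero]
      rw [max_eq_left (hq u), max_eq_left (by linarith [hmin u hu])]; ring
  rw [e3, e4]
  have := mul_le_mul_of_nonneg_left (hiso S) (hq u0)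
  nlinarith

lemma cheeger [DecidableEq V] (nb : V → Finset V) (hs : ∀ u v, u ∈ nb v ↔ v ∈ nb u) (d : ℕ)
    (hd : ∀ v, (nb v).card = d) (ι : ℝ) (h0ι : 0 ≤ ι)
    (hiso : ∀ K : Finset V, ι * K.card ≤ ∑ u ∈ K, ((nb u \ K).card : ℝ)) (h : V →₀ ℝ) :
    (ip (adj nb h) h)^2 ≤ ((d:ℝ)^2 - ι^2) * (ip h h)^2 := by
  set S := h.support with hS
  set T := S ∪ S.biUnion nb with hT
  have hST : S ⊆ T := Finset.subset_union_left
  have hnT : ∀ u ∈ S, nb u ⊆ T := fun u hu v hv =>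
    Finset.mem_union_right _ (Finset.mem_biUnion.2 ⟨u, hu, hv⟩)
  have hz : ∀ u, u ∉ S → h u = 0 := fun u hu => Finsupp.notMem_support_iff.1 hu
  set w : V → V → ℝ := fun u v => if v ∈ nb u then 1 else 0 with hw
  have hwn : ∀ u v, 0 ≤ w u v := by intro u v; simp only [hw]; split_ifs <;> norm_num
  have hws : ∀ u v, w u v = w v u := by intro u v; simp only [hw, hs u v]
  have hww : ∀ u v, w u v * w u v = w u v := by intro u v; simp only [hw]; split_ifs <;> norm_num
  have hsum : ∀ u ∈ S, ∀ F : V → ℝ, ∑ v ∈ T, w u v * F v = ∑ v ∈ nb u, F v := by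
    intro u hu F
    simp only [hw, ite_mul, one_mul, zero_mul]
    rw [← Finset.sum_filter, Finset.filter_mem_eq_inter, Finset.inter_eq_right.2 (hnT u hu)]
  have hN : ip h h = ∑ u ∈ T, h u * h u := ip_eq _ _ _ hST
  have hSS : ip (adj nb h) h = ∑ u ∈ T, ∑ v ∈ T, w u v * (h u * h v) := by
    rw [ip_comm, ip_eq h _ T hST]
    refine Finset.sum_congr rfl fun u _ => ?_
    by_cases hu : u ∈ S
    · rw [hsum u hu (fun v => h u * h v), adj_apply nb hs, Finset.mul_sum]
    · simp [hz u hu]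
  have hD : ∑ u ∈ T, ∑ v ∈ T, w u v * (h u * h u) = d * ip h h := by
    rw [hN, Finset.mul_sum]
    refine Finset.sum_congr rfl fun u _ => ?_
    by_cases hu : u ∈ S
    · rw [hsum u hu (fun v => h u * h u)]; simp [hd]
    · simp [hz u hu]
  have hD' : ∑ u ∈ T, ∑ v ∈ T, w u v * (h v * h v) = d * ip h h := by
    rw [← hD, Finset.sum_comm]
    refine Finset.sum_congr rfl fun u _ => Finset.sum_congr rfl fun v _ => ?_
    rw [hws]
  have hm : ∑ u ∈ T, ∑ v ∈ T, w u v * (h u - h v)^2 = 2 * d * ip h h - 2 * ip (adj nb h) h := by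
    have : ∀ u v, w u v * (h u - h v)^2 = w u v * (h u * h u) + w u v * (h v * h v)
      - 2 * (w u v * (h u * h v)) := by intros; ring
    simp only [this, Finset.sum_sub_distrib, Finset.sum_add_distrib, ← Finset.mul_sum, hD, hD', hSS]
    ring
  have hp : ∑ u ∈ T, ∑ v ∈ T, w u v * (h u + h v)^2 = 2 * d * ip h h + 2 * ip (adj nb h) h := by
    have : ∀ u v, w u v * (h u + h v)^2 = w u v * (h u * h u) + w u v * (h v * h v)
      + 2 * (w u v * (h u * h v)) := by intros; ring
    simp only [this, Finset.sum_add_distrib, ← Finset.mul_sum, hD, hD', hSS]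
    ring
  have hc := coarea nb ι hiso S (fun u => h u ^ 2) (fun u => sq_nonneg _)
    (fun u hu => by simp [hz u hu])
  set P := ∑ u ∈ T, ∑ v ∈ T, w u v * max (h u ^2 - h v ^2) 0 with hP
  have hPc : ι * ip h h ≤ P := by
    rw [ip_eq h h S subset_rfl]
    calc _ = ι * ∑ u ∈ S, h u ^ 2 := by simp only [sq]
      _ ≤ _ := hc
      _ = ∑ u ∈ S, ∑ v ∈ T, w u v * max (h u ^2 - h v ^2) 0 :=
        Finset.sum_congr rfl fun u hu => (hsum u hu _).symm
      _ ≤ P := Finset.sum_le_sum_of_subset_of_nonneg hST fun u _ _ =>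
        Finset.sum_nonneg fun v _ => mul_nonneg (hwn _ _) (le_max_right _ _)
  have hPP : ∑ u ∈ T, ∑ v ∈ T, (w u v * |h u - h v|) * (w u v * |h u + h v|) = 2 * P := by
    have e : ∀ u v, (w u v * |h u - h v|) * (w u v * |h u + h v|) =
        w u v * max (h u ^2 - h v ^2) 0 + w v u * max (h v ^2 - h u ^2) 0 := by
      intro u v
      rw [hws v u, ← mul_add]
      have : |h u - h v| * |h u + h v| = max (h u ^2 - h v ^2) 0 + max (h v ^2 - h u ^2) 0 := by
        rw [← abs_mul, show (h u - h v) * (h u + h v) = h u^2 - h v^2 by ring]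
        rcases le_total (h u ^2) (h v ^2) with hh | hh
        · rw [abs_of_nonpos (by linarith), max_eq_right (by linarith), max_eq_left (by linarith)]; ring
        · rw [abs_of_nonneg (by linarith), max_eq_left (by linarith), max_eq_right (by linarith)]; ring
      rw [← this]
      linear_combination (|h u - h v| * |h u + h v|) * hww u v
    simp only [e, Finset.sum_add_distrib]
    rw [Finset.sum_comm (f := fun u v => w v u * max (h v ^2 - h u ^2) 0)]
    rw [hP]; ring
  have hCS := Finset.sum_mul_sq_le_sq_mul_sq (T ×ˢ T) (fun p => w p.1 p.2 * |h p.1 - h p.2|)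
    (fun p => w p.1 p.2 * |h p.1 + h p.2|)
  simp only [Finset.sum_product, mul_pow, sq_abs] at hCS
  rw [hPP] at hCS
  have hw2 : ∀ u v, w u v ^ 2 = w u v := by intro u v; rw [sq, hww]
  simp only [hw2, hm, hp] at hCS
  have : (ι * ip h h)^2 ≤ P^2 :=
    pow_le_pow_left₀ (mul_nonneg h0ι (ip_self_nonneg h)) hPc 2
  nlinarith

lemma norm_bound [DecidableEq V] (nb : V → Finset V) (hs : ∀ u v, u ∈ nb v ↔ v ∈ nb u)
    (ρ : ℝ) (hρ : 0 ≤ ρ) (hb : ∀ h : V →₀ ℝ, |ip (adj nb h) h| ≤ ρ * ip h h) (f : V →₀ ℝ) :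
    ip (adj nb f) (adj nb f) ≤ ρ^2 * ip f f := by
  have key : ∀ s : ℝ, 2 * s * ip (adj nb f) (adj nb f) ≤
      ρ * ip f f + ρ * s^2 * ip (adj nb f) (adj nb f) := by
    intro s
    have h1 := (abs_le.1 (hb (f + s • adj nb f))).2
    have h2 := (abs_le.1 (hb (f + (-s) • adj nb f))).1
    simp only [map_add, map_smul, ip_add_left, ip_add_right, ip_smul_left, ip_smul_right] at h1 h2
    have h3 : ip (adj nb (adj nb f)) f = ip (adj nb f) (adj nb f) := adj_symm nb hs _ _
    rw [h3] at h1 h2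
    nlinarith
  rcases hρ.eq_or_lt with rfl | hpos
  · have := key 1; linarith
  · have := key (ρ⁻¹)
    have e : ρ * ρ⁻¹^2 = ρ⁻¹ := by field_simp
    rw [e] at this
    have h4 : ρ⁻¹ * ip (adj nb f) (adj nb f) ≤ ρ * ip f f := by linarith
    have := mul_le_mul_of_nonneg_left h4 hρ
    rw [← mul_assoc, mul_inv_cancel₀ hpos.ne'] at this
    linarith

lemma pow_symm (nb : V → Finset V) (hs : ∀ u v, u ∈ nb v ↔ v ∈ nb u) (n : ℕ) (f g : V →₀ ℝ) :
    ip ((adj nb ^ n) f) g = ip f ((adj nb ^ n) g) := by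
  induction n generalizing f g with
  | zero => simp
  | succ n ih => 
    rw [pow_succ, Module.End.mul_apply, ih, adj_symm nb hs, ← Module.End.mul_apply, ← pow_succ',
      pow_succ]

lemma return_upper [DecidableEq V] (nb : V → Finset V) (hs : ∀ u v, u ∈ nb v ↔ v ∈ nb u)
    (ρ : ℝ) (hρ : 0 ≤ ρ) (hb : ∀ h : V →₀ ℝ, |ip (adj nb h) h| ≤ ρ * ip h h) (x : V) (n : ℕ) :
    ((adj nb ^ n) (Finsupp.single x 1)) x ≤ ρ ^ n := by
  set δ : V →₀ ℝ := Finsupp.single x 1 with hδ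
  have h1 : ip δ δ = 1 := by rw [hδ, ip_single_left]; simp
  have hE : ∀ m : ℕ, ip ((adj nb ^ m) δ) ((adj nb ^ m) δ) ≤ (ρ ^ m)^2 := by
    intro m
    induction m with
    | zero => simp [h1]
    | succ m ih =>
      rw [pow_succ', Module.End.mul_apply]
      refine (norm_bound nb hs ρ hρ hb _).trans ?_
      calc _ ≤ ρ^2 * (ρ^m)^2 := mul_le_mul_of_nonneg_left ih (sq_nonneg _)
        _ = _ := by ring
  have h2 : ((adj nb ^ n) δ) x = ip ((adj nb ^ n) δ) δ := by
    rw [hδ, ip_single_right, one_mul]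
  rw [h2]
  have := ip_cs ((adj nb ^ n) δ) δ
  rw [h1, mul_one] at this
  exact (abs_le_of_sq_le_sq' (this.trans (hE n)) (pow_nonneg hρ n)).2

lemma adj_nonneg (nb : V → Finset V) (hs : ∀ u v, u ∈ nb v ↔ v ∈ nb u) (f : V →₀ ℝ)
    (hf : ∀ u, 0 ≤ f u) (n : ℕ) : ∀ u, 0 ≤ ((adj nb ^ n) f) u := by
  induction n with
  | zero => simpa using hf
  | succ n ih =>
    intro u
    rw [pow_succ', Module.End.mul_apply, adj_apply nb hs]
    exact Finset.sum_nonneg fun v _ => ih v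

lemma growth_move (nb : V → Finset V) (hs : ∀ u v, u ∈ nb v ↔ v ∈ nb u) (r : ℝ)
    (f : V →₀ ℝ) (hf : ∀ u, 0 ≤ f u) (x y : V)
    (hxy : Relation.ReflTransGen (fun u v => v ∈ nb u) x y)
    (hx : ∃ D : ℝ, ∀ n, ((adj nb ^ n) f) x ≤ D * r ^ n) :
    ∃ D : ℝ, ∀ n, ((adj nb ^ n) f) y ≤ D * r ^ n := by
  induction hxy with
  | refl => exact hx
  | @tail u v _ huv ih =>
    obtain ⟨D, hD⟩ := ih
    refine ⟨D * r, fun n => ?_⟩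
    have h1 := hD (n+1)
    rw [pow_succ', Module.End.mul_apply, adj_apply nb hs] at h1
    have h2 := Finset.single_le_sum (f := fun v => ((adj nb ^ n) f) v)
      (fun v _ => adj_nonneg nb hs f hf n v) huv
    calc _ ≤ _ := h2
      _ ≤ _ := h1
      _ = _ := by ring

lemma growth_all (nb : V → Finset V) (hs : ∀ u v, u ∈ nb v ↔ v ∈ nb u) (r : ℝ) (x : V)
    (hc : ∀ x y, Relation.ReflTransGen (fun u v => v ∈ nb u) x y)
    (hx : ∃ D : ℝ, ∀ n, ((adj nb ^ n) (Finsupp.single x 1)) x ≤ D * r ^ n)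
    (f : V →₀ ℝ) (hf : ∀ u, 0 ≤ f u) :
    ∃ D : ℝ, ∀ n, ip ((adj nb ^ n) f) f ≤ D * r ^ n := by
  classical
  have hδ : ∀ y u : V, 0 ≤ (Finsupp.single y (1:ℝ)) u := by
    intro y u; rw [Finsupp.single_apply]; split_ifs <;> norm_num
  have h1 : ∀ y z, ∃ D : ℝ, ∀ n, ((adj nb ^ n) (Finsupp.single y 1)) z ≤ D * r ^ n := by
    intro y z
    refine growth_move nb hs r _ (hδ y) x z (hc x z) ?_
    obtain ⟨D, hD⟩ := growth_move nb hs r _ (hδ x) x y (hc x y) hx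
    refine ⟨D, fun n => ?_⟩
    have := pow_symm nb hs n (Finsupp.single x 1) (Finsupp.single y 1)
    rw [ip_single_left, ip_single_right, one_mul, one_mul] at this
    rw [← this]; exact hD n
  choose D hD using h1
  refine ⟨∑ z ∈ f.support, f z * ∑ y ∈ f.support, f y * D y z, fun n => ?_⟩
  rw [ip_comm, ip_eq f _ _ subset_rfl, Finset.sum_mul]
  refine Finset.sum_le_sum fun z _ => ?_
  rw [mul_assoc]
  refine mul_le_mul_of_nonneg_left ?_ (hf z)
  have hfs : f = ∑ y ∈ f.support, f y • Finsupp.single y (1:ℝ) := by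
    conv_lhs => rw [← Finsupp.sum_single f]
    simp [Finsupp.sum]
  have e : ((adj nb ^ n) f) z = ∑ y ∈ f.support, f y * ((adj nb ^ n) (Finsupp.single y 1)) z := by
    conv_lhs => rw [hfs]
    simp only [map_sum, map_smul, Finsupp.finsetSum_apply, Finsupp.smul_apply, smul_eq_mul]
  rw [e, Finset.sum_mul]
  refine Finset.sum_le_sum fun y _ => ?_
  rw [mul_assoc]
  exact mul_le_mul_of_nonneg_left (hD y z n) (hf y)

lemma rate_lower (nb : V → Finset V) (hs : ∀ u v, u ∈ nb v ↔ v ∈ nb u) (r : ℝ) (hr : 0 < r)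
    (f : V →₀ ℝ) (l : ℝ) (hl : 0 ≤ l) (hN : 0 < ip f f) (hlf : l * ip f f ≤ ip (adj nb f) f)
    (hD : ∃ D : ℝ, ∀ n, ip ((adj nb ^ n) f) f ≤ D * r ^ n) : l ≤ r := by
  obtain ⟨D, hD⟩ := hD
  have h1 : ∀ k : ℕ, l ^ (2^k) * ip f f ≤ ip ((adj nb ^ (2^k)) f) f := by
    intro k
    induction k with
    | zero => simpa using hlf
    | succ k ih =>
      have h2 := ip_cs ((adj nb ^ (2^k)) f) f
      rw [← pow_symm nb hs, ← Module.End.mul_apply, ← pow_add, ← two_mul, ← pow_succ'] at h2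
      have h3 := pow_le_pow_left₀ (by positivity) ih 2
      have h4 : (l ^ (2^(k+1)) * ip f f) * ip f f ≤ ip ((adj nb ^ (2^(k+1))) f) f * ip f f := by
        calc _ = (l ^ (2^k) * ip f f)^2 := by rw [pow_succ 2 k, pow_mul]; ring
          _ ≤ _ := h3.trans h2
      exact le_of_mul_le_mul_right h4 hN
  by_contra hlt
  push Not at hlt
  have hq : 1 < l / r := (one_lt_div hr).2 hlt
  obtain ⟨n, hn⟩ := pow_unbounded_of_one_lt (D / ip f f) hq
  have h5 := (h1 n).trans (hD (2^n))
  have h6 : (l / r)^n ≤ (l/r)^(2^n) := pow_le_pow_right₀ hq.le Nat.lt_two_pow_self.le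
  have h7 := hn.trans_le h6
  rw [div_pow, div_lt_div_iff₀ hN (by positivity)] at h7
  linarith

lemma test_fun [DecidableEq V] (nb : V → Finset V) (hs : ∀ u v, u ∈ nb v ↔ v ∈ nb u) (d : ℕ)
    (hd0 : 2 ≤ d) (hd : ∀ v, (nb v).card = d) (K : Finset V) (hK : K.Nonempty) :
    ∃ f : V →₀ ℝ, (∀ u, 0 ≤ f u) ∧ 0 < ip f f ∧
      (d - (1 - (d:ℝ)⁻¹) * ((∑ u ∈ K, ((nb u \ K).card : ℝ)) / K.card)) * ip f f
        ≤ ip (adj nb f) f := by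
  set N := K.biUnion nb \ K with hNdef
  set t : ℝ := (d:ℝ)⁻¹ with ht
  have hdpos : (0:ℝ) < d := by positivity
  have ht0 : 0 < t := by positivity
  have hdisj : Disjoint K N := Finset.disjoint_sdiff
  set B : ℝ := ∑ u ∈ K, ((nb u \ K).card : ℝ) with hB
  let F : V → ℝ := fun u => if u ∈ K then 1 else if u ∈ N then t else 0
  have hF0 : ∀ u, 0 ≤ F u := by
    intro u; simp only [F]; split_ifs <;> positivity
  have hFK : ∀ u ∈ K, F u = 1 := by intro u hu; simp [F, hu]
  have hFN : ∀ u ∈ N, F u = t := by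
    intro u hu
    have : u ∉ K := (Finset.mem_sdiff.1 hu).2
    simp [F, hu, this]
  let f : V →₀ ℝ := Finsupp.onFinset (K ∪ N) F (by
    intro u hu
    by_contra h
    rw [Finset.mem_union, not_or] at h
    exact hu (by simp [F, h.1, h.2]))
  have hfF : ∀ u, f u = F u := fun u => rfl
  have hsup : f.support ⊆ K ∪ N := Finsupp.support_onFinset_subset
  have hff : ip f f = K.card + t^2 * N.card := by
    rw [ip_eq f f _ hsup, Finset.sum_union hdisj]
    congr 1
    · rw [Finset.sum_congr rfl (g := fun _ => (1:ℝ)) (fun u hu => by rw [hfF, hFK u hu, one_mul])]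
      simp
    · rw [Finset.sum_congr rfl (g := fun _ => t^2) (fun u hu => by rw [hfF, hFN u hu, sq])]
      simp [mul_comm]
  have hKN : ∑ u ∈ K, ∑ v ∈ nb u, F v = d * K.card - B + t * B := by
    have : ∀ u ∈ K, ∑ v ∈ nb u, F v = d - ((nb u \ K).card : ℝ) + t * ((nb u \ K).card : ℝ) := by
      intro u hu
      have hc : ((nb u ∩ K).card : ℝ) + ((nb u \ K).card : ℝ) = d := by
        have := Finset.card_inter_add_card_sdiff (nb u) K
        rw [hd] at this
        exact_mod_cast this
      have h1 : ∑ v ∈ nb u ∩ K, F v = ((nb u ∩ K).card : ℝ) := by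
        rw [Finset.sum_congr rfl (fun v hv => hFK v (Finset.mem_inter.1 hv).2)]; simp
      have h2 : ∑ v ∈ nb u \ K, F v = t * ((nb u \ K).card : ℝ) := by
        rw [Finset.sum_congr rfl (fun v hv => hFN v (by
          rw [Finset.mem_sdiff] at hv ⊢
          exact ⟨Finset.mem_biUnion.2 ⟨u, hu, hv.1⟩, hv.2⟩))]
        simp [mul_comm]
      rw [← Finset.sum_inter_add_sum_sdiff (nb u) K, h1, h2]
      linarith
    rw [Finset.sum_congr rfl this, Finset.sum_add_distrib, Finset.sum_sub_distrib,
      ← Finset.mul_sum, ← hB, Finset.sum_const, nsmul_eq_mul, mul_comm (d:ℝ)]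
  have hswap : ∑ u ∈ N, ((nb u ∩ K).card : ℝ) = B := by
    have h1 : ∀ u ∈ N, ((nb u ∩ K).card : ℝ) = ∑ v ∈ K, if v ∈ nb u then (1:ℝ) else 0 := by
      intro u _
      rw [Finset.sum_boole, Finset.filter_mem_eq_inter, Finset.inter_comm]
    have h2 : ∀ v ∈ K, ((nb v \ K).card : ℝ) = ∑ u ∈ N, if v ∈ nb u then (1:ℝ) else 0 := by
      intro v hv
      rw [Finset.sum_boole]
      congr 2
      ext u
      simp only [hNdef, Finset.mem_sdiff, Finset.mem_filter, Finset.mem_biUnion, hs v u]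
      constructor
      · rintro ⟨a, b⟩; exact ⟨⟨⟨v, hv, a⟩, b⟩, a⟩
      · rintro ⟨⟨_, b⟩, a⟩; exact ⟨a, b⟩
    rw [Finset.sum_congr rfl h1, hB, Finset.sum_congr rfl h2, Finset.sum_comm]
  have hNB : (N.card : ℝ) ≤ B := by
    rw [← hswap, Finset.cast_card]
    refine Finset.sum_le_sum fun u hu => ?_
    have hu' := Finset.mem_sdiff.1 hu
    obtain ⟨v, hv, huv⟩ := Finset.mem_biUnion.1 hu'.1
    have : 0 < (nb u ∩ K).card :=
      Finset.card_pos.2 ⟨v, Finset.mem_inter.2 ⟨(hs u v).1 huv, hv⟩⟩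
    exact_mod_cast this
  have hNN : t * B ≤ ∑ u ∈ N, F u * ∑ v ∈ nb u, F v := by
    rw [← hswap, Finset.mul_sum]
    refine Finset.sum_le_sum fun u hu => ?_
    rw [hFN u hu]
    refine mul_le_mul_of_nonneg_left ?_ ht0.le
    calc ((nb u ∩ K).card : ℝ) = ∑ v ∈ nb u ∩ K, F v := by
          rw [Finset.sum_congr rfl (fun v hv => hFK v (Finset.mem_inter.1 hv).2)]; simp
      _ ≤ _ := Finset.sum_le_sum_of_subset_of_nonneg Finset.inter_subset_left fun v _ _ => hF0 v
  have hAf : d * K.card - B + 2 * t * B ≤ ip (adj nb f) f := by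
    rw [ip_comm, ip_eq f _ _ hsup, Finset.sum_union hdisj]
    simp only [adj_apply nb hs, hfF]
    have : ∑ u ∈ K, F u * ∑ v ∈ nb u, F v = d * K.card - B + t * B := by
      rw [← hKN]
      exact Finset.sum_congr rfl fun u hu => by rw [hFK u hu, one_mul]
    linarith
  have hk : (0:ℝ) < K.card := by exact_mod_cast hK.card_pos
  refine ⟨f, hF0, by
    rw [hff]
    exact add_pos_of_pos_of_nonneg hk (mul_nonneg (sq_nonneg t) (Nat.cast_nonneg _)), ?_⟩
  refine le_trans ?_ hAf
  rw [hff]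
  have hB0 : 0 ≤ B := Finset.sum_nonneg fun _ _ => Nat.cast_nonneg _
  have htle : t ≤ 1 := inv_le_one_of_one_le₀ (by exact_mod_cast (by omega : 1 ≤ d))
  have hdt : d * t = 1 := mul_inv_cancel₀ hdpos.ne'
  have hBk : B / K.card * K.card = B := div_mul_cancel₀ _ hk.ne'
  have hpos : 0 ≤ (1 - t) * (B / K.card) * (t^2 * N.card) := by
    have : 0 ≤ 1 - t := by linarith
    exact mul_nonneg (mul_nonneg this (div_nonneg hB0 hk.le))
      (mul_nonneg (sq_nonneg t) (Nat.cast_nonneg _))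
  have h8 : d * (t^2 * N.card) ≤ t * B := by
    calc d * (t^2 * N.card) = (d * t) * t * N.card := by ring
      _ = t * N.card := by rw [hdt]; ring
      _ ≤ _ := mul_le_mul_of_nonneg_left hNB ht0.le
  have h9 : (d - (1 - t) * (B / K.card)) * (K.card + t^2 * N.card) =
      d * K.card - (1 - t) * (B / K.card * K.card) + d * (t^2 * N.card)
      - (1 - t) * (B / K.card) * (t^2 * N.card) := by ring
  rw [h9, hBk]
  linarith

lemma walk_count (Γ : SimpleGraph V) (nb : V → Finset V) (hnb : ∀ u v, v ∈ nb u ↔ Γ.Adj u v)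
    (hs : ∀ u v, u ∈ nb v ↔ v ∈ nb u) (z : V) (n : ℕ) :
    ∀ x, Finite {w : Γ.Walk x z // w.length = n} ∧
      (Nat.card {w : Γ.Walk x z // w.length = n} : ℝ) = ((adj nb ^ n) (Finsupp.single z 1)) x := by
  classical
  induction n with
  | zero =>
    intro x
    by_cases h : x = z
    · subst h
      have : Unique {w : Γ.Walk x x // w.length = 0} :=
        { default := ⟨.nil, rfl⟩
          uniq := by
            rintro ⟨w, hw⟩
            cases w with
            | nil => rfl
            | cons h p => simp at hw }
      refine ⟨inferInstance, ?_⟩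
      rw [Nat.card_unique]
      simp
    · have : IsEmpty {w : Γ.Walk x z // w.length = 0} :=
        ⟨fun w => h (SimpleGraph.Walk.eq_of_length_eq_zero w.2)⟩
      refine ⟨inferInstance, ?_⟩
      rw [Nat.card_of_isEmpty]
      simp [Ne.symm h]
  | succ n ih =>
    intro x
    let e : {w : Γ.Walk x z // w.length = n + 1} ≃
        Σ y : {y // y ∈ nb x}, {w : Γ.Walk y.1 z // w.length = n} :=
      { toFun := fun w => match w with
          | ⟨.cons (v := y) h p, hw⟩ => ⟨⟨y, (hnb _ _).2 h⟩, ⟨p, by simpa using hw⟩⟩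
        invFun := fun s => ⟨.cons ((hnb _ _).1 s.1.2) s.2.1, by simp [s.2.2]⟩
        left_inv := by
          rintro ⟨w, hw⟩
          cases w with
          | nil => simp at hw
          | cons h p => rfl
        right_inv := by
          rintro ⟨⟨y, hy⟩, ⟨p, hp⟩⟩
          rfl }
    have : ∀ y : {y // y ∈ nb x}, Finite {w : Γ.Walk y.1 z // w.length = n} := fun y => (ih y.1).1
    refine ⟨Finite.of_equiv _ e.symm, ?_⟩
    rw [Nat.card_congr e, Nat.card_sigma, pow_succ', Module.End.mul_apply, adj_apply nb hs]
    push_cast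
    rw [← Finset.sum_coe_sort (nb x) (fun v => ((adj nb ^ n) (Finsupp.single z 1)) v)]
    exact Finset.sum_congr rfl fun (y : {y // y ∈ nb x}) _ => (ih y.1).2

lemma boundary_card [DecidableEq V] (Γ : SimpleGraph V) (nb : V → Finset V)
    (hnb : ∀ u v, v ∈ nb u ↔ Γ.Adj u v) (K : Finset V) :
    ({e : V × V | Γ.Adj e.1 e.2 ∧ e.1 ∈ K ∧ e.2 ∉ K}.ncard : ℝ) =
      ∑ u ∈ K, ((nb u \ K).card : ℝ) := by
  have : {e : V × V | Γ.Adj e.1 e.2 ∧ e.1 ∈ K ∧ e.2 ∉ K} =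
      (Equiv.sigmaEquivProd V V) '' ((K.sigma (fun u => nb u \ K) : Finset (Σ _ : V, V)) : Set _) := by
    ext ⟨a, b⟩
    simp only [Set.mem_ofPred_eq, Set.mem_image, Finset.mem_coe, Finset.mem_sigma, Finset.mem_sdiff, hnb]
    constructor
    · rintro ⟨h1, h2, h3⟩; exact ⟨⟨a, b⟩, ⟨h2, h1, h3⟩, rfl⟩
    · rintro ⟨⟨a', b'⟩, ⟨h2, h1, h3⟩, h⟩
      cases h
      exact ⟨h1, h2, h3⟩
  rw [this, Set.ncard_image_of_injective _ (Equiv.injective _), Set.ncard_coe_finset,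
    Finset.card_sigma]
  push_cast
  rfl

lemma bound_all (a : ℕ → ℝ) (r : ℝ) (hr : 0 < r) (h : ∀ᶠ n in atTop, a n ≤ r ^ n) :
    ∃ D : ℝ, ∀ n, a n ≤ D * r ^ n := by
  obtain ⟨n0, hn0⟩ := eventually_atTop.1 h
  refine ⟨1 + ∑ i ∈ Finset.range n0, |a i| / r^i, fun n => ?_⟩
  have hsn : 0 ≤ ∑ i ∈ Finset.range n0, |a i| / r^i :=
    Finset.sum_nonneg fun _ _ => by positivity
  have hrn : 0 < r ^ n := by positivity
  by_cases hn : n0 ≤ n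
  · nlinarith [hn0 n hn]
  · have h1 := Finset.single_le_sum (f := fun i => |a i| / r^i) (s := Finset.range n0)
      (fun _ _ => by positivity) (Finset.mem_range.2 (not_le.1 hn))
    have h2 : |a n| / r^n * r^n = |a n| := div_mul_cancel₀ _ hrn.ne'
    have h3 := le_abs_self (a n)
    have h4 := mul_le_mul_of_nonneg_right h1 hrn.le
    simp only [h2] at h4
    nlinarith

end
end IsoSpec

/-- Let `Γ` be a `d`-regular graph with isoperimetric constant `ι` and
spectral radius `μ` of the simple random walk. Then
`1 - ((d-1)/d²)·ι ≤ μ ≤ √(1 - (ι/d)²)`. -/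
theorem isoperimetric_spectral_radius {V : Type*} (Γ : SimpleGraph V)
    (hconn : Γ.Connected) (d : ℕ) (hd : 2 ≤ d)
    (hreg : ∀ v : V, (Γ.neighborSet v).ncard = d)
    (ι : ℝ)
    (hι : ι = sInf {r : ℝ | ∃ K : Finset V, K.Nonempty ∧
      r = ({e : V × V | Γ.Adj e.1 e.2 ∧ e.1 ∈ K ∧ e.2 ∉ K}.ncard : ℝ) / K.card})
    (x : V) (μ : ℝ)
    (hμ : μ = Filter.limsup
      (fun n : ℕ => ((Nat.card {w : Γ.Walk x x // w.length = n} : ℝ) / d ^ n) ^ ((n : ℝ)⁻¹))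
      Filter.atTop) :
    1 - ((d - 1 : ℝ) / d ^ 2) * ι ≤ μ ∧ μ ≤ Real.sqrt (1 - (ι / d) ^ 2) := by
  classical
  have hfin : ∀ v, (Γ.neighborSet v).Finite := fun v =>
    Set.finite_of_ncard_ne_zero (by rw [hreg]; omega)
  let nb : V → Finset V := fun v => (hfin v).toFinset
  have hnb : ∀ u v, v ∈ nb u ↔ Γ.Adj u v := by intro u v; simp [nb]
  have hs : ∀ u v, u ∈ nb v ↔ v ∈ nb u := by
    intro u v; rw [hnb, hnb, Γ.adj_comm]
  have hcard : ∀ v, (nb v).card = d := fun v => by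
    rw [← hreg v, Set.ncard_eq_toFinset_card _ (hfin v)]
  have hdpos : (0:ℝ) < d := by positivity
  simp only [IsoSpec.boundary_card Γ nb hnb] at hι
  have hcnt : ∀ n, (Nat.card {w : Γ.Walk x x // w.length = n} : ℝ) =
      ((IsoSpec.adj nb ^ n) (Finsupp.single x 1)) x :=
    fun n => (IsoSpec.walk_count Γ nb hnb hs x n x).2
  simp only [hcnt] at hμ
  set a : ℕ → ℝ := fun n => ((IsoSpec.adj nb ^ n) (Finsupp.single x 1)) x with ha
  have ha0 : ∀ n, 0 ≤ a n := fun n => by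
    simp only [ha]; rw [← hcnt]; exact Nat.cast_nonneg _
  have hc : ∀ x y, Relation.ReflTransGen (fun u v => v ∈ nb u) x y := by
    intro x y
    have := (SimpleGraph.reachable_iff_reflTransGen x y).1 (hconn.preconnected x y)
    exact Relation.ReflTransGen.mono (fun u v h => (hnb u v).2 h) _ _ this
  set R : Set ℝ := {r : ℝ | ∃ K : Finset V, K.Nonempty ∧
      r = (∑ u ∈ K, ((nb u \ K).card : ℝ)) / K.card} with hR
  have hRn : R.Nonempty := ⟨_, {x}, Finset.singleton_nonempty x, rfl⟩
  have hR0 : ∀ r ∈ R, 0 ≤ r := by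
    rintro r ⟨K, _, rfl⟩
    exact div_nonneg (Finset.sum_nonneg fun _ _ => Nat.cast_nonneg _) (Nat.cast_nonneg _)
  have hι0 : 0 ≤ ι := by rw [hι]; exact le_csInf hRn hR0
  have hiso : ∀ K : Finset V, ι * K.card ≤ ∑ u ∈ K, ((nb u \ K).card : ℝ) := by
    intro K
    rcases K.eq_empty_or_nonempty with rfl | hK
    · simp
    · have hk : (0:ℝ) < K.card := by exact_mod_cast hK.card_pos
      rw [← le_div_iff₀ hk, hι]
      exact csInf_le ⟨0, hR0⟩ ⟨K, hK, rfl⟩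
  have hch := IsoSpec.cheeger nb hs d hcard ι hι0 hiso
  have hnn : 0 ≤ (d:ℝ)^2 - ι^2 := by
    have := hch (Finsupp.single x 1)
    have h1 : IsoSpec.ip (Finsupp.single x (1:ℝ)) (Finsupp.single x (1:ℝ)) = 1 := by
      rw [IsoSpec.ip_single_left]; simp
    rw [h1, one_pow, mul_one] at this
    exact (sq_nonneg _).trans this
  set ρ := Real.sqrt ((d:ℝ)^2 - ι^2) with hρ
  have hρ0 : 0 ≤ ρ := Real.sqrt_nonneg _
  have hup : ∀ n, a n ≤ ρ ^ n := fun n => by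
    refine IsoSpec.return_upper nb hs ρ hρ0 (fun h => ?_) x n
    refine abs_le_of_sq_le_sq ?_ (mul_nonneg hρ0 (IsoSpec.ip_self_nonneg h))
    rw [mul_pow, hρ, Real.sq_sqrt hnn]
    exact hch h
  set b : ℕ → ℝ := fun n => (a n / d ^ n) ^ ((n : ℝ)⁻¹) with hb
  have hb0 : ∀ n, 0 ≤ b n := fun n =>
    Real.rpow_nonneg (div_nonneg (ha0 n) (by positivity)) _
  have hbn : ∀ᶠ n in atTop, b n ≤ ρ / d := by
    filter_upwards [eventually_ge_atTop 1] with n hn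
    calc b n ≤ ((ρ / d)^n) ^ ((n : ℝ)⁻¹) := by
          refine Real.rpow_le_rpow (div_nonneg (ha0 n) (by positivity)) ?_ (by positivity)
          rw [div_pow]
          exact div_le_div_of_nonneg_right (hup n) (by positivity)
      _ = ρ / d := Real.pow_rpow_inv_natCast (by positivity) (by omega)
  have hbdd : IsBoundedUnder (· ≤ ·) atTop b := ⟨ρ / d, eventually_map.2 hbn⟩
  have hcob : IsCoboundedUnder (· ≤ ·) atTop b :=
    IsBoundedUnder.isCoboundedUnder_le ⟨0, eventually_map.2 (Eventually.of_forall hb0)⟩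
  constructor
  · have hcc : 0 < (d - 1 : ℝ) / d ^ 2 := by
      have : (2:ℝ) ≤ d := by exact_mod_cast hd
      have : (0:ℝ) < d - 1 := by linarith
      positivity
    have hmain : (1 - μ) / ((d - 1 : ℝ) / d ^ 2) ≤ ι := by
      rw [hι]
      refine le_csInf hRn ?_
      rintro _ ⟨K, hK, rfl⟩
      rw [div_le_iff₀ hcc]
      obtain ⟨f, hf0, hfp, hf⟩ := IsoSpec.test_fun nb hs d hd hcard K hK
      have hk : (0:ℝ) < K.card := by exact_mod_cast hK.card_pos
      set q := (∑ u ∈ K, ((nb u \ K).card : ℝ)) / K.card with hq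
      have hqd : q ≤ d := by
        rw [hq, div_le_iff₀ hk]
        calc _ ≤ ∑ u ∈ K, (d:ℝ) := Finset.sum_le_sum fun u _ => by
              rw [← hcard u]; exact_mod_cast Finset.card_le_card Finset.sdiff_subset
          _ = _ := by simp [mul_comm]
      set l := (d:ℝ) - (1 - (d:ℝ)⁻¹) * q with hl
      have hdi : (d:ℝ) * (d:ℝ)⁻¹ = 1 := mul_inv_cancel₀ hdpos.ne'
      have hdi1 : (d:ℝ)⁻¹ ≤ 1 := inv_le_one_of_one_le₀ (by exact_mod_cast (by omega : 1 ≤ d))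
      have hlpos : 0 < l := by nlinarith
      have hld : l / d = 1 - q * ((d - 1 : ℝ) / d ^ 2) := by
        rw [hl]; field_simp
      have hgoal : l / d ≤ μ := by
        by_contra hlt
        push Not at hlt
        obtain ⟨r, hr1, hr2⟩ := exists_between (max_lt hlt (div_pos hlpos hdpos))
        have hrμ : μ < r := (le_max_left _ _).trans_lt hr1
        have hr0 : 0 < r := (le_max_right _ _).trans_lt hr1
        rw [hμ] at hrμ
        have hev := eventually_lt_of_limsup_lt hrμ hbdd
        have hev2 : ∀ᶠ n in atTop, a n ≤ (r * d) ^ n := by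
          filter_upwards [hev, eventually_ge_atTop 1] with n hn hn1
          have h0 : 0 ≤ a n / d ^ n := div_nonneg (ha0 n) (by positivity)
          have h1 : a n / d ^ n ≤ r ^ n := by
            calc a n / d ^ n = ((a n / d ^ n) ^ ((n:ℝ)⁻¹)) ^ n :=
                  (Real.rpow_inv_natCast_pow h0 (by omega)).symm
              _ ≤ r ^ n := pow_le_pow_left₀ (hb0 n) hn.le n
          rw [div_le_iff₀ (by positivity)] at h1
          rwa [mul_pow]
        have hle := IsoSpec.rate_lower nb hs (r * d) (by positivity) f l hlpos.le hfp hf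
          (IsoSpec.growth_all nb hs (r * d) x hc
            (IsoSpec.bound_all a (r * d) (by positivity) hev2) f hf0)
        rw [lt_div_iff₀ hdpos] at hr2
        linarith
      linarith
    rw [div_le_iff₀ hcc] at hmain
    linarith
  · have : Real.sqrt (1 - (ι / d) ^ 2) = ρ / d := by
      have e : 1 - (ι / d) ^ 2 = ((d:ℝ)^2 - ι^2) / (d:ℝ)^2 := by field_simp
      rw [e, Real.sqrt_div hnn, Real.sqrt_sq hdpos.le]
    rw [this, hμ]
    exact limsup_le_of_le hcob hbn
end

section
/- (Chomsky–Schützenberger) The growth series of the language generated by an unambiguous context-free grammar is an algebraic formal power series: there is a nonzero polynomial P(X,Y) ∈ ℤ[X,Y] with P(X, f(X)) = 0, where f(X) = Σ_{w ∈ L} X^{|w|}. -/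
open Polynomial

/-- A leftmost rewriting step of a context-free grammar: the leftmost
nonterminal is replaced using one of the rules. -/
def LeftmostStep {T : Type} (g : ContextFreeGrammar T)
    (u v : List (Symbol T g.NT)) : Prop :=
  ∃ (r : ContextFreeRule T g.NT) (p : List T) (s : List (Symbol T g.NT)),
    r ∈ g.rules ∧
    u = (p.map Symbol.terminal) ++ [Symbol.nonterminal r.input] ++ s ∧
    v = (p.map Symbol.terminal) ++ r.output ++ s

/-- A leftmost derivation of the word `word` from the axiom. -/
def IsLeftmostDerivation {T : Type} (g : ContextFreeGrammar T)
    (ds : List (List (Symbol T g.NT))) (word : List T) : Prop :=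
  ds.head? = some [Symbol.nonterminal g.initial] ∧
  ds.getLast? = some (word.map Symbol.terminal) ∧
  ds.Chain' (LeftmostStep g)

/-- A grammar is unambiguous if every word of its language has a unique
leftmost derivation. -/
def Unambiguous {T : Type} (g : ContextFreeGrammar T) : Prop :=
  ∀ w ∈ g.language, ∃! ds : List (List (Symbol T g.NT)), IsLeftmostDerivation g ds w


/-- Chain rule for a derivation composed with the evaluation of a multivariate polynomial. -/
theorem cs_chain_rule {K E M ι : Type*} [CommRing K] [CommRing E] [Algebra K E]
    [AddCommGroup M] [Module K M] [Module E M] [IsScalarTower K E M] [Fintype ι]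
    (D : Derivation K E M) (y : ι → E) (p : MvPolynomial ι K) :
    D (MvPolynomial.aeval y p) =
      ∑ j, MvPolynomial.aeval y (MvPolynomial.pderiv j p) • D (y j) := by
  classical
  induction p using MvPolynomial.induction_on with
  | C a => simp
  | add p q hp hq => simp [hp, hq, add_smul, Finset.sum_add_distrib]
  | mul_X p i hp =>
    simp only [map_mul, MvPolynomial.aeval_X, Derivation.leibniz, hp, map_add, smul_eq_mul,
      add_smul, Finset.sum_add_distrib, MvPolynomial.pderiv_X, Finset.smul_sum, mul_smul]
    congr 1
    rw [Finset.sum_eq_single i]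
    · simp
    · intro j _ hj
      simp [hj.symm]
    · simp

theorem cs_jacobian_field {K L ι : Type*} [Field K] [Field L] [Algebra K L] [Fintype ι]
    [DecidableEq ι] (y : ι → L) (p : ι → MvPolynomial ι K)
    (hp : ∀ i, MvPolynomial.aeval y (p i) = 0)
    (hdet : (Matrix.of fun i j => MvPolynomial.aeval y (MvPolynomial.pderiv j (p i))).det ≠ 0)
    (i : ι) : IsAlgebraic K (y i) := by
  classical
  let E := IntermediateField.adjoin K (Set.range y)
  let z : ι → E := fun i => ⟨y i, IntermediateField.subset_adjoin _ _ ⟨i, rfl⟩⟩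
  have hz : ∀ q : MvPolynomial ι K, algebraMap E L (MvPolynomial.aeval z q) =
      MvPolynomial.aeval y q := by
    intro q
    rw [← MvPolynomial.aeval_algebraMap_apply]
    rfl
  have hpz : ∀ i, MvPolynomial.aeval z (p i) = 0 := by
    intro i
    apply (algebraMap E L).injective
    rw [hz, hp, map_zero]
  let J : Matrix ι ι E :=
    Matrix.of fun i j => MvPolynomial.aeval z (MvPolynomial.pderiv j (p i))
  have hJ : J.det ≠ 0 := by
    intro h
    apply hdet
    have := congrArg (algebraMap E L) h
    rw [map_zero, RingHom.map_det] at this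
    rw [← this]
    congr 1
    ext i j
    simp [J, hz]
  let D := KaehlerDifferential.D K E
  have hDz : ∀ k, D (z k) = 0 := by
    intro k
    have h1 : ∀ i, ∑ j, J i j • D (z j) = 0 := by
      intro i
      have := cs_chain_rule D z (p i)
      rw [hpz, map_zero] at this
      exact this.symm
    have h2 : ∑ j, (J.adjugate * J) k j • D (z j) = 0 := by
      simp only [Matrix.mul_apply, Finset.sum_smul, mul_smul]
      rw [Finset.sum_comm]
      simp only [← Finset.smul_sum, h1, smul_zero, Finset.sum_const_zero]
    rw [Matrix.adjugate_mul] at h2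
    simp only [Matrix.smul_apply, Matrix.one_apply, smul_eq_mul, mul_ite, mul_one, mul_zero,
      ite_smul, zero_smul, Finset.sum_ite_eq, Finset.mem_univ, if_true] at h2
    exact (smul_eq_zero.mp h2).resolve_left hJ
  have hD : ∀ x : E, D x = 0 := by
    rintro ⟨x, hx⟩
    induction hx using IntermediateField.adjoin_induction with
    | mem x hx =>
      obtain ⟨k, rfl⟩ := hx
      exact hDz k
    | algebraMap x => exact D.map_algebraMap x
    | add x y hx hy h1 h2 =>
      have := D.map_add ⟨x, hx⟩ ⟨y, hy⟩
      rw [h1, h2, add_zero] at this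
      exact this
    | inv x hx h =>
      have := D.leibniz_inv ⟨x, hx⟩
      rw [h, smul_zero] at this
      exact this
    | mul x y hx hy h1 h2 =>
      have := D.leibniz ⟨x, hx⟩ ⟨y, hy⟩
      rw [h1, h2, smul_zero, smul_zero, add_zero] at this
      exact this
  have hfu : Algebra.FormallyUnramified K E := by
    constructor
    rw [← Submodule.subsingleton_iff E, ← subsingleton_iff_bot_eq_top,
      ← KaehlerDifferential.span_range_derivation]
    symm
    rw [Submodule.span_eq_bot]
    rintro _ ⟨x, rfl⟩
    exact hD x
  have hess : Algebra.EssFiniteType K E := by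
    rw [IntermediateField.essFiniteType_iff]
    have := IntermediateField.fg_adjoin_finset (F := K) (Finset.univ.image y)
    simpa [E] using this
  have := Algebra.FormallyUnramified.isSeparable K E
  have h := Algebra.IsAlgebraic.isAlgebraic (R := K) (z i)
  exact h.algebraMap (A := L)

theorem cs_jacobian {A R ι : Type*} [CommRing A] [IsDomain A] [CommRing R] [IsDomain R]
    [Algebra A R] [FaithfulSMul A R] [Fintype ι]
    [DecidableEq ι] (y : ι → R) (p : ι → MvPolynomial ι A)
    (hp : ∀ i, MvPolynomial.aeval y (p i) = 0)
    (hdet : (Matrix.of fun i j => MvPolynomial.aeval y (MvPolynomial.pderiv j (p i))).det ≠ 0)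
    (i : ι) : IsAlgebraic A (y i) := by
  let K := FractionRing A
  let L := FractionRing R
  have : FaithfulSMul A L := FaithfulSMul.trans A R L
  let _ : Algebra K L := FractionRing.liftAlgebra A L
  have hy : ∀ q : MvPolynomial ι A, MvPolynomial.aeval (fun i => algebraMap R L (y i))
      (MvPolynomial.map (algebraMap A K) q) = algebraMap R L (MvPolynomial.aeval y q) := by
    intro q
    rw [MvPolynomial.aeval_map_algebraMap, ← MvPolynomial.aeval_algebraMap_apply]
    rfl
  have key := cs_jacobian_field (K := K) (L := L) (fun i => algebraMap R L (y i))
    (fun i => MvPolynomial.map (algebraMap A K) (p i)) (fun i => by rw [hy, hp, map_zero])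
    (by
      intro h
      apply hdet
      apply IsFractionRing.injective R L
      rw [map_zero, RingHom.map_det, ← h]
      congr 1
      ext i j
      simp [MvPolynomial.pderiv_map, hy]) i
  rw [← IsFractionRing.isAlgebraic_iff A K L] at key
  exact (isAlgebraic_algebraMap_iff (IsFractionRing.injective R L)).mp key

/-- Specialisation of the auxiliary variable `t` at `1`. -/
theorem cs_specialize (G : PowerSeries (Polynomial ℤ))
    (hG : IsAlgebraic (Polynomial (Polynomial ℤ))
      (PowerSeries.map (Polynomial.coeToPowerSeries.ringHom (R := ℤ)) G)) :
    ∃ P : Polynomial (Polynomial ℤ), P ≠ 0 ∧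
      Polynomial.eval₂ Polynomial.coeToPowerSeries.ringHom
        (PowerSeries.map (Polynomial.evalRingHom (1 : ℤ)) G) P = 0 := by
  obtain ⟨P, hP0, hP⟩ := hG
  let a : Polynomial (Polynomial (Polynomial ℤ)) := C (C (X - C 1))
  have ha : ¬ IsUnit a := by
    intro h
    rw [Polynomial.isUnit_C, Polynomial.isUnit_C] at h
    exact Polynomial.not_isUnit_X_sub_C 1 h
  obtain ⟨Q, hPQ, hQ⟩ :=
    (FiniteMultiplicity.of_not_isUnit ha hP0).exists_eq_pow_mul_and_not_dvd
  have hinj : Function.Injective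
      (PowerSeries.map (Polynomial.coeToPowerSeries.ringHom (R := ℤ))) := by
    intro f g h
    ext1 n
    have := congrArg (PowerSeries.coeff n) h
    simp only [PowerSeries.coeff_map] at this
    exact Polynomial.coe_injective ℤ this
  have hev : ∀ q : Polynomial (Polynomial (Polynomial ℤ)),
      Polynomial.aeval (PowerSeries.map (Polynomial.coeToPowerSeries.ringHom (R := ℤ)) G) q =
      PowerSeries.map (Polynomial.coeToPowerSeries.ringHom (R := ℤ))
        (Polynomial.eval₂ Polynomial.coeToPowerSeries.ringHom G q) := by
    intro q
    rw [Polynomial.hom_eval₂, Polynomial.aeval_def]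
    congr 1
  have hPB : Polynomial.eval₂ Polynomial.coeToPowerSeries.ringHom G P = 0 := by
    apply hinj
    rw [← hev, hP, map_zero]
  have hQB : Polynomial.eval₂ Polynomial.coeToPowerSeries.ringHom G Q = 0 := by
    rw [hPQ, Polynomial.eval₂_mul, Polynomial.eval₂_pow] at hPB
    refine (mul_eq_zero.mp hPB).resolve_left (pow_ne_zero _ ?_)
    simp only [a, Polynomial.eval₂_C]
    intro h
    have h' : ((C (X - C 1 : ℤ[X]) : ℤ[X][X]) : PowerSeries ℤ[X]) = 0 := h
    rw [Polynomial.coe_eq_zero_iff, Polynomial.C_eq_zero] at h'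
    exact Polynomial.X_sub_C_ne_zero 1 h'
  refine ⟨Q.map (Polynomial.mapRingHom (Polynomial.evalRingHom 1)), ?_, ?_⟩
  · intro h
    apply hQ
    rw [Polynomial.C_dvd_iff_dvd_coeff]
    intro i
    rw [Polynomial.C_dvd_iff_dvd_coeff]
    intro j
    rw [Polynomial.dvd_iff_isRoot]
    have := congrArg (fun q => (q.coeff i).coeff j) h
    simpa using this
  · rw [Polynomial.eval₂_map]
    have := congrArg (PowerSeries.map (Polynomial.evalRingHom (1 : ℤ))) hQB
    rw [map_zero, Polynomial.hom_eval₂] at this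
    rw [← this]
    congr 1
    ext q m
    all_goals simp [PowerSeries.coeff_X, apply_ite (Polynomial.eval 1)]

instance cs_faithful :
    FaithfulSMul (Polynomial (Polynomial ℤ)) (PowerSeries (PowerSeries ℤ)) := by
  rw [faithfulSMul_iff_algebraMap_injective]
  intro p q h
  ext1 n
  have := congrArg (PowerSeries.coeff n) h
  simp only [PowerSeries.algebraMap_apply', PowerSeries.coeff_map, Polynomial.coeff_coe] at this
  simp only [Algebra.algebraMap_self, PowerSeries.map_id, RingHom.id_apply] at this
  exact Polynomial.coe_injective ℤ this

/-- The multiset of words obtained from `u` by leftmost derivations with `n` steps. -/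
noncomputable def csWords {T : Type} (g : ContextFreeGrammar T) :
    ℕ → List (Symbol T g.NT) → Multiset (List T)
  | n, [] => if n = 0 then {[]} else 0
  | n, Symbol.terminal a :: u => (csWords g n u).map (a :: ·)
  | 0, Symbol.nonterminal _ :: _ => 0
  | n+1, Symbol.nonterminal A :: u => by
      classical
      exact ∑ r ∈ g.rules with r.input = A, csWords g n (r.output ++ u)
termination_by n u => (n, u.length)

theorem csWords_append {T : Type} (g : ContextFreeGrammar T) (n : ℕ) (p : List T)
    (u : List (Symbol T g.NT)) :
    csWords g n (p.map Symbol.terminal ++ u) = (csWords g n u).map (p ++ ·) := by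
  induction p with
  | nil => simp
  | cons a p ih => simp [csWords.eq_2, ih, Multiset.map_map]

theorem csWords_terminal {T : Type} (g : ContextFreeGrammar T) (n : ℕ) (p : List T) :
    csWords g n (p.map Symbol.terminal) = if n = 0 then {p} else 0 := by
  have := csWords_append g n p []
  rw [List.append_nil] at this
  rw [this, csWords.eq_1]
  split_ifs <;> simp

theorem csWords_zero_nonterminal {T : Type} (g : ContextFreeGrammar T) (p : List T) (A : g.NT)
    (s : List (Symbol T g.NT)) :
    csWords g 0 (p.map Symbol.terminal ++ [Symbol.nonterminal A] ++ s) = 0 := by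
  rw [List.append_assoc, csWords_append]
  simp [csWords.eq_3]

open Classical in
theorem csWords_succ_nonterminal {T : Type} (g : ContextFreeGrammar T) (n : ℕ) (p : List T)
    (A : g.NT) (s : List (Symbol T g.NT)) :
    csWords g (n + 1) (p.map Symbol.terminal ++ [Symbol.nonterminal A] ++ s) =
      ∑ r ∈ g.rules with r.input = A,
        csWords g n (p.map Symbol.terminal ++ r.output ++ s) := by
  rw [List.append_assoc, csWords_append, List.singleton_append, csWords.eq_4]
  rw [← Multiset.coe_mapAddMonoidHom, map_sum]
  apply Finset.sum_congr
  · congr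
  · intro r _
    rw [List.append_assoc, csWords_append]
    rfl

theorem cs_form {T N : Type} (u : List (Symbol T N)) :
    (∃ p : List T, u = p.map Symbol.terminal) ∨
    ∃ (p : List T) (A : N) (s : List (Symbol T N)),
      u = p.map Symbol.terminal ++ [Symbol.nonterminal A] ++ s := by
  induction u with
  | nil => exact Or.inl ⟨[], rfl⟩
  | cons x u ih =>
    cases x with
    | nonterminal A => exact Or.inr ⟨[], A, u, by simp⟩
    | terminal a =>
      rcases ih with ⟨p, rfl⟩ | ⟨p, A, s, rfl⟩
      · exact Or.inl ⟨a :: p, by simp⟩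
      · exact Or.inr ⟨a :: p, A, s, by simp⟩

theorem cs_form_unique {T N : Type} (p q : List T) (A B : N) (s t : List (Symbol T N))
    (h : p.map Symbol.terminal ++ [Symbol.nonterminal A] ++ s =
      q.map Symbol.terminal ++ [Symbol.nonterminal B] ++ t) : p = q ∧ A = B ∧ s = t := by
  induction p generalizing q with
  | nil =>
    cases q with
    | nil => simpa using h
    | cons b q => simp at h
  | cons a p ih =>
    cases q with
    | nil => simp at h
    | cons b q =>
      simp only [List.map_cons, List.cons_append, List.cons.injEq, Symbol.terminal.injEq] at h
      obtain ⟨h1, h2⟩ := ih q h.2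
      exact ⟨by rw [h.1, h1], h2⟩

theorem cs_form_ne {T N : Type} (p q : List T) (A : N) (s : List (Symbol T N)) :
    p.map Symbol.terminal ≠ q.map Symbol.terminal ++ [Symbol.nonterminal A] ++ s := by
  intro h
  have : (Symbol.nonterminal A : Symbol T N) ∈ p.map (Symbol.terminal (N := N)) := by
    rw [h]; simp
  simp at this

theorem csWords_mem_succ {T : Type} (g : ContextFreeGrammar T) (n : ℕ)
    (u : List (Symbol T g.NT)) (w : List T) :
    w ∈ csWords g (n + 1) u ↔ ∃ v, LeftmostStep g u v ∧ w ∈ csWords g n v := by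
  classical
  rcases cs_form u with ⟨p, rfl⟩ | ⟨p, A, s, rfl⟩
  · rw [csWords_terminal]
    simp only [Nat.add_eq_zero_iff, one_ne_zero, and_false, if_false, Multiset.notMem_zero,
      false_iff]
    rintro ⟨v, ⟨r, q, t, -, h, -⟩, -⟩
    exact cs_form_ne _ _ _ _ h
  · rw [csWords_succ_nonterminal, Multiset.mem_sum]
    constructor
    · rintro ⟨r, hr, hw⟩
      rw [Finset.mem_filter] at hr
      exact ⟨_, ⟨r, p, s, hr.1, by rw [hr.2], rfl⟩, hw⟩
    · rintro ⟨v, ⟨r, q, t, hr, h, rfl⟩, hw⟩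
      obtain ⟨rfl, rfl, rfl⟩ := cs_form_unique _ _ _ _ _ _ h
      exact ⟨r, by simp [hr], hw⟩

theorem csWords_mem_zero {T : Type} (g : ContextFreeGrammar T)
    (u : List (Symbol T g.NT)) (w : List T) :
    w ∈ csWords g 0 u ↔ u = w.map Symbol.terminal := by
  rcases cs_form u with ⟨p, rfl⟩ | ⟨p, A, s, rfl⟩
  · rw [csWords_terminal]
    simp only [if_true, Multiset.mem_singleton]
    constructor
    · rintro rfl; rfl
    · intro h
      have hi : Function.Injective (Symbol.terminal : T → Symbol T g.NT) := by
        intro a b h; simpa using h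
      exact (List.map_injective_iff.mpr hi h).symm
  · rw [csWords_zero_nonterminal]
    simp only [Multiset.notMem_zero, false_iff]
    exact (cs_form_ne _ _ _ _).symm

/-- Leftmost derivations starting at an arbitrary sentential form. -/
def CsDer {T : Type} (g : ContextFreeGrammar T) (u : List (Symbol T g.NT)) (w : List T)
    (ds : List (List (Symbol T g.NT))) : Prop :=
  ds.head? = some u ∧ ds.getLast? = some (w.map Symbol.terminal) ∧
    ds.IsChain (LeftmostStep g)

theorem CsDer.cons {T : Type} {g : ContextFreeGrammar T} {u v : List (Symbol T g.NT)}
    {w : List T} {ds : List (List (Symbol T g.NT))} (h : LeftmostStep g u v)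
    (hd : CsDer g v w ds) : CsDer g u w (u :: ds) := by
  obtain ⟨h1, h2, h3⟩ := hd
  cases ds with
  | nil => simp at h1
  | cons x ds =>
    simp only [List.head?_cons, Option.some.injEq] at h1
    subst h1
    exact ⟨rfl, by simpa using h2, by simp [h, h3]⟩

theorem csWords_mem_iff {T : Type} (g : ContextFreeGrammar T) (n : ℕ)
    (u : List (Symbol T g.NT)) (w : List T) :
    w ∈ csWords g n u ↔ ∃ ds, CsDer g u w ds ∧ ds.length = n + 1 := by
  induction n generalizing u with
  | zero =>
    rw [csWords_mem_zero]
    constructor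
    · rintro rfl
      exact ⟨[w.map Symbol.terminal], ⟨rfl, rfl, by simp⟩, rfl⟩
    · rintro ⟨ds, ⟨h1, h2, h3⟩, h⟩
      obtain ⟨x, rfl⟩ := List.length_eq_one_iff.mp h
      simp at h1 h2
      rw [← h1, h2]
  | succ n ih =>
    rw [csWords_mem_succ]
    constructor
    · rintro ⟨v, hv, hw⟩
      obtain ⟨ds, hds, hl⟩ := (ih v).mp hw
      exact ⟨u :: ds, hds.cons hv, by simp [hl]⟩
    · rintro ⟨ds, ⟨h1, h2, h3⟩, h⟩
      match ds, h with
      | x :: y :: ds, h =>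
        simp only [List.head?_cons, Option.some.injEq] at h1
        subst h1
        rw [List.isChain_cons_cons] at h3
        refine ⟨y, h3.1, (ih y).mpr ⟨y :: ds, ⟨rfl, by simpa using h2, h3.2⟩, by simpa using h⟩⟩

open Classical in
theorem csWords_count_le {T : Type} (g : ContextFreeGrammar T) (n : ℕ)
    (u : List (Symbol T g.NT)) (w : List T)
    (hu : ∀ ds ds', CsDer g u w ds → CsDer g u w ds' → ds = ds') :
    (csWords g n u).count w ≤ 1 := by
  induction n generalizing u with
  | zero =>
    rcases cs_form u with ⟨p, rfl⟩ | ⟨p, A, s, rfl⟩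
    · rw [csWords_terminal, if_pos rfl, Multiset.count_singleton]
      split_ifs <;> simp
    · rw [csWords_zero_nonterminal]; simp
  | succ n ih =>
    rcases cs_form u with ⟨p, rfl⟩ | ⟨p, A, s, rfl⟩
    · rw [csWords_terminal]; simp
    · rw [csWords_succ_nonterminal, Multiset.count_sum']
      have hstep : ∀ r ∈ g.rules.filter (fun r => r.input = A),
          LeftmostStep g (p.map Symbol.terminal ++ [Symbol.nonterminal A] ++ s)
            (p.map Symbol.terminal ++ r.output ++ s) := by
        intro r hr
        rw [Finset.mem_filter] at hr
        exact ⟨r, p, s, hr.1, by rw [hr.2], rfl⟩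
      by_cases hall : ∀ r ∈ g.rules.filter (fun r => r.input = A),
          (csWords g n (p.map Symbol.terminal ++ r.output ++ s)).count w = 0
      · rw [Finset.sum_eq_zero hall]; simp
      · push Not at hall
        obtain ⟨r, hr, hrw⟩ := hall
        rw [Finset.sum_eq_single_of_mem r hr]
        · apply ih
          intro ds ds' hd hd'
          have := hu _ _ (hd.cons (hstep r hr)) (hd'.cons (hstep r hr))
          simpa using this
        · intro r' hr' hne
          by_contra hc
          have m1 := Multiset.count_ne_zero.mp hrw
          have m2 := Multiset.count_ne_zero.mp hc
          rw [csWords_mem_iff] at m1 m2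
          obtain ⟨ds, hd, -⟩ := m1
          obtain ⟨ds', hd', -⟩ := m2
          have := hu _ _ (hd.cons (hstep r hr)) (hd'.cons (hstep r' hr'))
          simp only [List.cons.injEq, true_and] at this
          subst this
          have h1 := hd.1
          rw [hd'.1] at h1
          simp only [Option.some.injEq, List.append_assoc, List.append_cancel_left_eq,
            List.append_cancel_right_eq] at h1
          rw [Finset.mem_filter] at hr hr'
          exact hne (ContextFreeRule.ext (hr'.2.trans hr.2.symm) h1)

theorem cs_der_language {T : Type} {g : ContextFreeGrammar T} (n : ℕ)
    (u : List (Symbol T g.NT)) (w : List T) (h : w ∈ csWords g n u) :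
    g.Derives u (w.map Symbol.terminal) := by
  induction n generalizing u with
  | zero =>
    rw [csWords_mem_zero] at h
    rw [h]
  | succ n ih =>
    rw [csWords_mem_succ] at h
    obtain ⟨v, ⟨r, p, s, hr, rfl, rfl⟩, hw⟩ := h
    exact ContextFreeGrammar.Produces.trans_derives
      ⟨r, hr, r.rewrites_of_exists_parts _ _⟩ (ih _ hw)

/-- The bivariate series counting leftmost derivations by word length (outer variable)
and number of steps (inner variable). -/
noncomputable def csW {T : Type} (g : ContextFreeGrammar T) (u : List (Symbol T g.NT)) :
    PowerSeries (PowerSeries ℤ) :=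
  PowerSeries.mk fun m => PowerSeries.mk fun n =>
    ((csWords g n u).countP (fun w => w.length = m) : ℤ)

theorem csW_nil {T : Type} (g : ContextFreeGrammar T) : csW g [] = 1 := by
  ext m n
  simp only [csW, PowerSeries.coeff_mk, csWords.eq_1, PowerSeries.coeff_one]
  by_cases hn : n = 0
  · by_cases hm : m = 0
    · simp [hn, hm, Multiset.countP_eq_card_filter, Multiset.filter_singleton]
    · simp [hn, hm, Ne.symm hm, Multiset.countP_eq_card_filter, Multiset.filter_singleton]
  · by_cases hm : m = 0
    · simp [hn, hm, PowerSeries.coeff_one]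
    · simp [hn, hm]

theorem csW_terminal {T : Type} (g : ContextFreeGrammar T) (a : T)
    (u : List (Symbol T g.NT)) :
    csW g (Symbol.terminal a :: u) = PowerSeries.X * csW g u := by
  ext m n
  cases m with
  | zero => simp [csW, csWords.eq_2, Multiset.countP_map]
  | succ m =>
    rw [PowerSeries.coeff_succ_X_mul]
    simp only [csW, csWords.eq_2, PowerSeries.coeff_mk, Multiset.countP_map, List.length_cons,
      add_left_inj, ← Multiset.countP_eq_card_filter]

open Classical in
theorem csW_nonterminal {T : Type} (g : ContextFreeGrammar T) (A : g.NT)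
    (u : List (Symbol T g.NT)) :
    csW g (Symbol.nonterminal A :: u) = PowerSeries.C PowerSeries.X *
      ∑ r ∈ g.rules with r.input = A, csW g (r.output ++ u) := by
  ext m n
  rw [PowerSeries.coeff_C_mul]
  cases n with
  | zero => simp [csW, csWords.eq_3]
  | succ n =>
    rw [PowerSeries.coeff_succ_X_mul]
    simp only [csW, map_sum, PowerSeries.coeff_mk, csWords.eq_4]
    rw [← Nat.cast_sum]
    congr 1
    rw [← Multiset.coe_countPAddMonoidHom, map_sum]

theorem cs_unique {T : Type} (g : ContextFreeGrammar T)
    (Δ : List (Symbol T g.NT) → PowerSeries (PowerSeries ℤ)) (h0 : Δ [] = 0)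
    (h1 : ∀ a u, Δ (Symbol.terminal a :: u) = PowerSeries.X * Δ u)
    (h2 : ∀ A u, ∃ s : Finset (ContextFreeRule T g.NT), Δ (Symbol.nonterminal A :: u) =
      PowerSeries.C PowerSeries.X * ∑ r ∈ s, Δ (r.output ++ u)) (u : List (Symbol T g.NT)) :
    Δ u = 0 := by
  have key : ∀ (n : ℕ) (u : List (Symbol T g.NT)),
      (PowerSeries.C PowerSeries.X : PowerSeries (PowerSeries ℤ)) ^ n ∣ Δ u := by
    intro n
    induction n with
    | zero => simp
    | succ n ih =>
      intro u
      induction u with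
      | nil => rw [h0]; exact dvd_zero _
      | cons x u ihu =>
        cases x with
        | terminal a => rw [h1]; exact ihu.mul_left _
        | nonterminal A =>
          obtain ⟨s, hs⟩ := h2 A u
          rw [hs, pow_succ']
          exact mul_dvd_mul_left _ (Finset.dvd_sum fun r _ => ih _)
  ext m n
  obtain ⟨q, hq⟩ := key (n + 1) u
  rw [hq, ← map_pow, PowerSeries.coeff_C_mul, PowerSeries.coeff_X_pow_mul']
  simp

theorem csW_append {T : Type} (g : ContextFreeGrammar T) (u v : List (Symbol T g.NT)) :
    csW g (u ++ v) = csW g u * csW g v := by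
  classical
  rw [← sub_eq_zero]
  refine cs_unique g (fun u => csW g (u ++ v) - csW g u * csW g v) ?_ ?_ ?_ u
  · simp [csW_nil]
  · intro a u
    simp only [List.cons_append, csW_terminal]
    ring
  · intro A u
    refine ⟨g.rules.filter (fun r => r.input = A), ?_⟩
    simp only [List.cons_append, csW_nonterminal, Finset.sum_sub_distrib, List.append_assoc,
      ← Finset.sum_mul]
    ring

theorem csW_prod {T : Type} (g : ContextFreeGrammar T) (u : List (Symbol T g.NT)) :
    csW g u = (u.map fun s => csW g [s]).prod := by
  induction u with
  | nil => simp [csW_nil]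
  | cons x u ih =>
    rw [List.map_cons, List.prod_cons, ← ih, ← csW_append]
    rfl

open Classical in
/-- The finite set of nonterminals that are the input of some rule. -/
noncomputable def csInputs {T : Type} (g : ContextFreeGrammar T) : Finset g.NT :=
  g.rules.image (fun r => r.input)

open Classical in
/-- The polynomial variable attached to a symbol. -/
noncomputable def csSym {T : Type} (g : ContextFreeGrammar T) :
    Symbol T g.NT → MvPolynomial {A : g.NT // A ∈ csInputs g} (ℤ[X][X])
  | Symbol.terminal _ => MvPolynomial.C X
  | Symbol.nonterminal B =>
      if h : B ∈ csInputs g then MvPolynomial.X ⟨B, h⟩ else 0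

theorem csW_eq_zero {T : Type} (g : ContextFreeGrammar T) (A : g.NT)
    (hA : ∀ r ∈ g.rules, r.input ≠ A) : csW g [Symbol.nonterminal A] = 0 := by
  classical
  rw [csW_nonterminal, Finset.sum_eq_zero, mul_zero]
  intro r hr
  rw [Finset.mem_filter] at hr
  exact absurd hr.2 (hA r hr.1)

theorem csSym_aeval {T : Type} (g : ContextFreeGrammar T) (s : Symbol T g.NT) :
    MvPolynomial.aeval (fun i : {A : g.NT // A ∈ csInputs g} =>
      csW g [Symbol.nonterminal i.1]) (csSym g s) = csW g [s] := by
  classical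
  cases s with
  | terminal a =>
    simp [csSym, csW_terminal, csW_nil, PowerSeries.algebraMap_apply']
  | nonterminal B =>
    by_cases h : B ∈ csInputs g
    · simp only [csSym, dif_pos h, MvPolynomial.aeval_X]
    · simp only [csSym, dif_neg h, map_zero]
      symm
      apply csW_eq_zero
      intro r hr he
      exact h (Finset.mem_image.mpr ⟨r, hr, he⟩)

theorem csW_algebraic {T : Type} (g : ContextFreeGrammar T) (A : g.NT) :
    IsAlgebraic (ℤ[X][X]) (csW g [Symbol.nonterminal A]) := by
  classical
  by_cases hA : A ∈ csInputs g
  swap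
  · rw [csW_eq_zero]
    · exact isAlgebraic_zero
    · intro r hr he
      exact hA (Finset.mem_image.mpr ⟨r, hr, he⟩)
  have hCX : algebraMap (ℤ[X][X]) (PowerSeries (PowerSeries ℤ)) (C X : ℤ[X][X]) =
      PowerSeries.C PowerSeries.X := by
    simp [PowerSeries.algebraMap_apply']
  let Q : {A : g.NT // A ∈ csInputs g} →
      MvPolynomial {A : g.NT // A ∈ csInputs g} (ℤ[X][X]) :=
    fun i => ∑ r ∈ g.rules with r.input = i.1, (r.output.map (csSym g)).prod
  refine cs_jacobian (A := ℤ[X][X])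
    (fun i : {A : g.NT // A ∈ csInputs g} => csW g [Symbol.nonterminal i.1])
    (fun i => MvPolynomial.X i - MvPolynomial.C (C X : ℤ[X][X]) * Q i) ?_ ?_ ⟨A, hA⟩
  · intro i
    rw [map_sub, map_mul, MvPolynomial.aeval_X, MvPolynomial.aeval_C, hCX, sub_eq_zero,
      csW_nonterminal, map_sum]
    congr 1
    apply Finset.sum_congr rfl
    intro r _
    rw [List.append_nil, map_list_prod, List.map_map, csW_prod]
    congr 2
    funext s
    exact (csSym_aeval g s).symm
  · intro h
    have h' := congrArg (PowerSeries.map (PowerSeries.constantCoeff (R := ℤ))) h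
    rw [map_zero, RingHom.map_det] at h'
    refine one_ne_zero (α := PowerSeries ℤ) ?_
    rw [← h', ← Matrix.det_one (n := {A : g.NT // A ∈ csInputs g})]
    congr 1
    ext1 i j
    simp only [RingHom.mapMatrix_apply, Matrix.map_apply, Matrix.of_apply, map_sub,
      MvPolynomial.pderiv_X, MvPolynomial.pderiv_C_mul, map_mul, MvPolynomial.aeval_C, hCX,
      PowerSeries.map_C, PowerSeries.constantCoeff_X, map_zero, zero_mul, sub_zero,
      MvPolynomial.smul_eq_C_mul]
    by_cases hij : i = j
    · subst hij; simp
    · simp [hij]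

/-- Chomsky–Schützenberger: the growth series
`f(X) = Σ_{w ∈ L(Γ)} X^{|w|}` of the language generated by an unambiguous
context-free grammar is algebraic: there is a nonzero polynomial
`P(X,Y) ∈ ℤ[X][Y]` with `P(X, f(X)) = 0`. -/
theorem chomsky_schutzenberger {T : Type} [Fintype T]
    (g : ContextFreeGrammar T) (hg : Unambiguous g)
    (f : PowerSeries ℤ)
    (hf : f = PowerSeries.mk fun n =>
      (Nat.card {w : List T // w ∈ g.language ∧ w.length = n} : ℤ)) :
    ∃ P : Polynomial (Polynomial ℤ), P ≠ 0 ∧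
      Polynomial.eval₂ Polynomial.coeToPowerSeries.ringHom f P = 0 := by
  classical
  let S : List (Symbol T g.NT) := [Symbol.nonterminal g.initial]
  have hex : ∀ w ∈ g.language, ∃ n, w ∈ csWords g n S := by
    intro w hw
    obtain ⟨ds, hds, -⟩ := hg w hw
    have hne : ds ≠ [] := by
      rintro rfl
      simpa using hds.1
    refine ⟨ds.length - 1, (csWords_mem_iff _ _ _ _).mpr ⟨ds, hds, ?_⟩⟩
    have := List.length_pos_iff.mpr hne
    omega
  have hlang : ∀ n w, w ∈ csWords g n S → w ∈ g.language := fun n w h =>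
    cs_der_language n S w h
  have huniq : ∀ w ∈ g.language, ∀ ds ds', CsDer g S w ds → CsDer g S w ds' → ds = ds' := by
    intro w hw ds ds' h h'
    exact (hg w hw).unique h h'
  have hnodup : ∀ n, (csWords g n S).Nodup := by
    intro n
    rw [Multiset.nodup_iff_count_le_one]
    intro w
    by_cases hw : w ∈ csWords g n S
    · have := csWords_count_le g n S w (huniq w (hlang n w hw))
      convert this
    · rw [Multiset.count_eq_zero_of_notMem hw]; simp
  choose! ν hν using hex
  have hν' : ∀ n w, w ∈ csWords g n S ↔ w ∈ g.language ∧ ν w = n := by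
    intro n w
    constructor
    · intro h
      have hw := hlang n w h
      refine ⟨hw, ?_⟩
      obtain ⟨ds, hd, hl⟩ := (csWords_mem_iff _ _ _ _).mp h
      obtain ⟨ds', hd', hl'⟩ := (csWords_mem_iff _ _ _ _).mp (hν w hw)
      rw [huniq w hw ds ds' hd hd'] at hl
      omega
    · rintro ⟨hw, rfl⟩
      exact hν w hw
  have hfin : ∀ m : ℕ, {w : List T | w ∈ g.language ∧ w.length = m}.Finite := fun m =>
    (List.finite_length_eq T m).subset fun w hw => hw.2
  let G : PowerSeries ℤ[X] := PowerSeries.mk fun m => ∑ w ∈ (hfin m).toFinset, X ^ ν w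
  have hGW : PowerSeries.map (Polynomial.coeToPowerSeries.ringHom (R := ℤ)) G = csW g S := by
    ext m n
    simp only [G, csW, PowerSeries.coeff_map, PowerSeries.coeff_mk,
      Polynomial.coeToPowerSeries.ringHom_apply, Polynomial.coeff_coe,
      Polynomial.finsetSum_coeff, Polynomial.coeff_X_pow]
    rw [Finset.sum_boole, Multiset.countP_eq_card_filter]
    norm_cast
    rw [← Multiset.toFinset_card_of_nodup ((hnodup n).filter _)]
    congr 1
    ext w
    simp only [Finset.mem_filter, Set.Finite.mem_toFinset, Set.mem_ofPred_eq,
      Multiset.mem_toFinset, Multiset.mem_filter, hν']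
    tauto
  have hGf : PowerSeries.map (Polynomial.evalRingHom (1 : ℤ)) G = f := by
    rw [hf]
    ext m
    simp only [G, PowerSeries.coeff_map, PowerSeries.coeff_mk, Polynomial.coe_evalRingHom,
      Polynomial.eval_finsetSum, Polynomial.eval_pow, Polynomial.eval_X, one_pow,
      Finset.sum_const, nsmul_eq_mul, mul_one]
    rw [← Set.ncard_eq_toFinset_card _ (hfin m)]
    rfl
  have halg := csW_algebraic g g.initial
  rw [← hGf]
  apply cs_specialize
  rw [hGW]
  exact halg
end
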